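/- Every string w of length n > 4 contains at most n − 3 runs. -/

import Mathlib

variable {α : Type*}

/-- The substring `w[i..j]` of a 1-indexed string given as a function `w : ℕ → α`. -/
def substr (w : ℕ → α) (i j : ℕ) : List α :=
  (List.range (j + 1 - i)).map (fun k => w (i + k))

/-- `u` is a Lyndon word w.r.t. the strict order `lt`:
`u` is nonempty and lexicographically smaller than each of its nonempty proper suffixes. -/
def IsLyndon (lt : α → α → Prop) (u : List α) : Prop :=
  u ≠ [] ∧ ∀ v, v ≠ [] → v ≠ u → v <:+ u → List.Lex lt u v

/-- `p` is a period of the substring `w[i..j]`. -/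
def IsPeriod (w : ℕ → α) (i j p : ℕ) : Prop :=
  ∀ k, i ≤ k → k + p ≤ j → w k = w (k + p)

/-- `(i,j,p)` is a run of the string `w[1..n]`. -/
def IsRun (w : ℕ → α) (n i j p : ℕ) : Prop :=
  1 ≤ i ∧ j ≤ n ∧ 1 ≤ p ∧ i + 2 * p ≤ j + 1 ∧
  IsPeriod w i j p ∧ (∀ q, 1 ≤ q → q < p → ¬ IsPeriod w i j q) ∧
  (i = 1 ∨ w (i - 1) ≠ w (i + p - 1)) ∧
  (j = n ∨ w (j + 1) ≠ w (j - p + 1))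

/-- The set of runs of the string `w[1..n]`, as triples `(i,j,p)`. -/
def Runs (w : ℕ → α) (n : ℕ) : Set (ℕ × ℕ × ℕ) :=
  { r | IsRun w n r.1 r.2.1 r.2.2 }

/-- The exponent of a run `(i,j,p)`, i.e. `(j-i+1)/p`, as a rational number. -/
def expo (r : ℕ × ℕ × ℕ) : ℚ :=
  ((r.2.1 : ℚ) - (r.1 : ℚ) + 1) / (r.2.2 : ℚ)

/-- `ŵ = w$`: positions `1..n` carry `w`, position `n+1` carries the sentinel `none`. -/
def hat (w : ℕ → α) (n : ℕ) : ℕ → Option α :=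
  fun i => if i ≤ n then some (w i) else none

/-- Extension of a strict order `lt` on `α` to `Option α`, where the sentinel `none`
is smaller than every letter if `small = true`, and larger otherwise. -/
def extLT (small : Bool) (lt : α → α → Prop) : Option α → Option α → Prop
  | none, none => False
  | none, some _ => small = true
  | some _, none => small = false
  | some a, some b => lt a b

/-- The order `≺_ℓ` on `Σ ∪ {$}` (for `ℓ ∈ {0,1}` encoded as `Bool`):
`$ ≺₀ a` and `a ≺₁ $` for every `a ∈ Σ`. -/
def hatOrd (lt0 lt1 : α → α → Prop) (ℓ : Bool) : Option α → Option α → Prop :=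
  extLT (!ℓ) (cond ℓ lt1 lt0)

/-- `[i..j] = λ_ℓ(i)`: `ŵ[i..j]` is the longest Lyndon word (w.r.t. `lt`)
starting at position `i` in `ŵ = ŵ[1..n+1]`. -/
def IsLongestLyndon (lt : Option α → Option α → Prop) (what : ℕ → Option α)
    (n i j : ℕ) : Prop :=
  i ≤ j ∧ j ≤ n + 1 ∧ IsLyndon lt (substr what i j) ∧
  ∀ j', j < j' → j' ≤ n + 1 → ¬ IsLyndon lt (substr what i j')

/-- `[iℓ..jℓ]` is an L-root of the run `(i,j,p)` w.r.t. `lt`. -/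
def IsLRoot (lt : α → α → Prop) (w : ℕ → α) (i j p iℓ jℓ : ℕ) : Prop :=
  i ≤ iℓ ∧ jℓ ≤ j ∧ jℓ + 1 = iℓ + p ∧ IsLyndon lt (substr w iℓ jℓ)

/-- The set `B_r` for the run `r = (i,j,p)` of `w[1..n]`: all L-roots
(as intervals, i.e. pairs `(iλ, jλ)`) of `r` w.r.t. the unique order `≺_ℓ`
with `ŵ[j+1] ≺_ℓ ŵ[j+1-p]`, except those starting at `i`. -/
def Br (lt0 lt1 : α → α → Prop) (w : ℕ → α) (n i j p : ℕ) : Set (ℕ × ℕ) :=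
  { q | ∃ ℓ : Bool, hatOrd lt0 lt1 ℓ (hat w n (j + 1)) (hat w n (j + 1 - p)) ∧
        IsLRoot (cond ℓ lt1 lt0) w i j p q.1 q.2 ∧ q.1 ≠ i }

/-- `p` is a period of the list `s` (0-indexed form of `s[k] = s[k+p]` for `1 ≤ k ≤ |s|-p`). -/
def ListPeriod (s : List α) (p : ℕ) : Prop :=
  ∀ k, k + p < s.length → s[k]? = s[k + p]?

/-- The interval `[s..s+p-1]` of `f` is a Lyndon word: it differs from each of its proper suffixes,
and is smaller at the first mismatch. -/
def LyndonAt (f : ℕ → ℤ) (s p : ℕ) : Prop :=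
  ∀ e, 0 < e → e < p → ∃ m, e + m < p ∧ (∀ x < m, f (s + x) = f (s + e + x)) ∧
    f (s + m) < f (s + e + m)

/-- `s` is the starting position of an L-root of the run `(i,j,p)`, other than `i`, with respect
to whichever of the order of `ℤ` and its reverse makes `f (j + 1)` smaller than `f (j + 1 - p)`. -/
def RootAt (f : ℕ → ℤ) (i j p s : ℕ) : Prop :=
  i < s ∧ s + p ≤ j + 1 ∧
    (f (j + 1) < f (j + 1 - p) ∧ LyndonAt f s p ∨ f (j + 1 - p) < f (j + 1) ∧ LyndonAt (-f) s p)

theorem exists_lyndonAt (f : ℕ → ℤ) {i j p : ℕ} (hp : 1 ≤ p) (hlen : i + 2 * p ≤ j + 1)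
    (hper : IsPeriod f i j p) (hmin : ∀ q, 1 ≤ q → q < p → ¬ IsPeriod f i j q) :
    ∃ s, i < s ∧ s ≤ i + p ∧ LyndonAt f s p := by
  have hf : ∀ k, i + k ≤ j → f (i + k) = f (i + k % p) := by
    intro k
    induction k using Nat.strong_induction_on with
    | _ k ih =>
      intro hk
      by_cases h : k < p
      · rw [Nat.mod_eq_of_lt h]
      · rw [Nat.mod_eq_sub_mod (by omega), ← ih (k - p) (by omega) (by omega),
          hper (i + (k - p)) (by omega) (by omega)]
        congr 1
        omega
  let G : ℕ → Lex (ℕ → ℤ) := fun d => toLex fun x => f (i + (d + x) % p)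
  have hG : ∀ d e, d % p = e % p → G d = G e := fun d e h => by
    apply congrArg toLex
    funext x
    rw [Nat.add_mod, h, ← Nat.add_mod]
  obtain ⟨d, hd, hdmin⟩ := Finset.exists_min_image (Finset.Icc 1 p) G ⟨1, by simp [hp]⟩
  rw [Finset.mem_Icc] at hd
  have hall : ∀ e, G d ≤ G e := by
    intro e
    rcases Nat.eq_zero_or_pos (e % p) with h | h
    · rw [hG e p (by simp [h])]
      exact hdmin p (by simp [hp])
    · rw [hG e (e % p) (by simp)]
      exact hdmin _ (by simpa using ⟨h, (Nat.mod_lt _ hp).le⟩)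
  refine ⟨i + d, by omega, by omega, fun e he hep => ?_⟩
  have hne : G d ≠ G (d + e) := by
    intro h
    refine hmin e he hep fun k hik hkj => ?_
    have hx := congrFun (congrArg ofLex h) (k - i + d * (p - 1))
    simp only [G, ofLex_toLex] at hx
    have hdp : d * p = d + d * (p - 1) := by
      obtain ⟨q, rfl⟩ : ∃ q, p = q + 1 := ⟨p - 1, by omega⟩
      simp; ring
    rw [show d + (k - i + d * (p - 1)) = k - i + d * p by omega,
      show d + e + (k - i + d * (p - 1)) = k - i + e + d * p by omega,
      Nat.add_mul_mod_self_right, Nat.add_mul_mod_self_right, ← hf _ (by omega),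
      ← hf _ (by omega)] at hx
    rwa [show i + (k - i) = k by omega, show i + (k - i + e) = k + e by omega] at hx
  obtain ⟨m, hm, hlt⟩ : ∃ m, (∀ x < m, f (i + (d + x) % p) = f (i + (d + e + x) % p)) ∧
      f (i + (d + m) % p) < f (i + (d + e + m) % p) := lt_of_le_of_ne (hall _) hne
  have hemp : e + m < p := by
    by_contra hcon
    refine (hall (d + (p - e))).not_gt ⟨m - (p - e), fun x hx => ?_, ?_⟩
    · change f (i + (d + (p - e) + x) % p) = f (i + (d + x) % p)
      have := hm (p - e + x) (by omega)
      rwa [show d + e + (p - e + x) = d + x + p by omega, Nat.add_mod_right, ← add_assoc] at this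
    · change f (i + (d + (p - e) + (m - (p - e))) % p) < f (i + (d + (m - (p - e))) % p)
      rwa [show d + e + m = d + (m - (p - e)) + p by omega, Nat.add_mod_right,
        show d + m = d + (p - e) + (m - (p - e)) by omega] at hlt
  refine ⟨m, hemp, fun x hx => ?_, ?_⟩
  · have := hm x hx
    rw [← hf _ (by omega), ← hf _ (by omega)] at this
    simpa only [add_assoc] using this
  · rw [← hf _ (by omega), ← hf _ (by omega)] at hlt
    simpa only [add_assoc] using hlt

theorem isPeriod_neg_iff (f : ℕ → ℤ) (i j p : ℕ) : IsPeriod (-f) i j p ↔ IsPeriod f i j p := by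
  simp [IsPeriod]

/-- A run cannot be extended to the right, also when it ends at `n`. -/
theorem IsRun.right_ne {f : ℕ → ℤ} {n i j p : ℕ} (hpos : ∀ k, 1 ≤ k → k ≤ n → 0 < f k)
    (hend : f (n + 1) = 0) (h : IsRun f n i j p) : f (j + 1) ≠ f (j + 1 - p) := by
  obtain ⟨h1, hjn, hp, hlen, -, -, -, hr⟩ := h
  rcases hr with rfl | hr
  · have := hpos (j + 1 - p) (by omega) (by omega)
    omega
  · rwa [show j + 1 - p = j - p + 1 by omega]

theorem IsRun.exists_rootAt {f : ℕ → ℤ} {n i j p : ℕ} (hpos : ∀ k, 1 ≤ k → k ≤ n → 0 < f k)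
    (hend : f (n + 1) = 0) (h : IsRun f n i j p) : ∃ s, RootAt f i j p s := by
  have hne := h.right_ne hpos hend
  obtain ⟨-, -, hp, hlen, hper, hmin, -, -⟩ := h
  rcases lt_or_gt_of_ne hne with hlt | hgt
  · obtain ⟨s, his, hsp, hL⟩ := exists_lyndonAt f hp hlen hper hmin
    exact ⟨s, his, by omega, Or.inl ⟨hlt, hL⟩⟩
  · obtain ⟨s, his, hsp, hL⟩ := exists_lyndonAt (-f) hp hlen ((isPeriod_neg_iff ..).2 hper)
      (by simpa only [isPeriod_neg_iff] using hmin)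
    exact ⟨s, his, by omega, Or.inr ⟨hgt, hL⟩⟩

/-- No Lyndon word starting at an L-root of a run is longer than that root. -/
theorem LyndonAt.le_period {f : ℕ → ℤ} {i j p q s : ℕ} (hper : IsPeriod f i j p) (hp : 1 ≤ p)
    (his : i ≤ s) (hsj : s + p ≤ j + 1) (hlt : f (j + 1) < f (j + 1 - p)) (hq : LyndonAt f s q) :
    q ≤ p := by
  by_contra hpq
  obtain ⟨m, -, heq, hm⟩ := hq p hp (by omega)
  rcases lt_trichotomy (s + p + m) (j + 1) with h | h | h
  · have := hper (s + m) (by omega) (by omega)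
    rw [show s + m + p = s + p + m by omega] at this
    omega
  · rw [h, show s + m = j + 1 - p by omega] at hm
    omega
  · have := heq (j + 1 - p - s) (by omega)
    rw [show s + (j + 1 - p - s) = j + 1 - p by omega,
      show s + p + (j + 1 - p - s) = j + 1 by omega] at this
    omega

theorem LyndonAt.lt_last {f : ℕ → ℤ} {s p : ℕ} (h : LyndonAt f s p) (hp : 2 ≤ p) :
    f s < f (s + p - 1) := by
  obtain ⟨m, hm, -, hlt⟩ := h (p - 1) (by omega) (by omega)
  obtain rfl : m = 0 := by omega
  simpa [show s + (p - 1) = s + p - 1 by omega] using hlt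

theorem RootAt.pred_eq {f : ℕ → ℤ} {n i j p s : ℕ} (hr : IsRun f n i j p)
    (h : RootAt f i j p s) : f (s - 1) = f (s + p - 1) := by
  obtain ⟨his, hsj, -⟩ := h
  rw [hr.2.2.2.2.1 (s - 1) (by omega) (by omega)]
  congr 1
  omega

theorem RootAt.period_eq {f : ℕ → ℤ} {n i j p i' j' p' s : ℕ}
    (hr : IsRun f n i j p) (hr' : IsRun f n i' j' p')
    (h : RootAt f i j p s) (h' : RootAt f i' j' p' s) : p = p' := by
  have e := h.pred_eq hr
  have e' := h'.pred_eq hr'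
  obtain ⟨-, -, hp, -, hper, -⟩ := hr
  obtain ⟨-, -, hp', -, hper', -⟩ := hr'
  obtain ⟨his, hsj, ⟨hlt, hL⟩ | ⟨hlt, hL⟩⟩ := h <;>
    obtain ⟨his', hsj', ⟨hlt', hL'⟩ | ⟨hlt', hL'⟩⟩ := h'
  · exact le_antisymm (hL.le_period hper' hp' his'.le hsj' hlt')
      (hL'.le_period hper hp his.le hsj hlt)
  rotate_right
  · exact le_antisymm
      (hL.le_period ((isPeriod_neg_iff ..).2 hper') hp' his'.le hsj' (by simpa using hlt'))
      (hL'.le_period ((isPeriod_neg_iff ..).2 hper) hp his.le hsj (by simpa using hlt))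
  all_goals
    rcases Nat.lt_or_ge 1 p with h2 | h2 <;> rcases Nat.lt_or_ge 1 p' with h2' | h2'
    · have a := hL.lt_last h2
      have b := hL'.lt_last h2'
      simp only [Pi.neg_apply] at a b
      omega
    · have a := hL.lt_last h2
      obtain rfl : p' = 1 := by omega
      simp only [Pi.neg_apply, Nat.add_sub_cancel] at a e'
      omega
    · have b := hL'.lt_last h2'
      obtain rfl : p = 1 := by omega
      simp only [Pi.neg_apply, Nat.add_sub_cancel] at b e
      omega
    · omega

theorem IsRun.start_le {α : Type*} {w : ℕ → α} {n i j p i' j' s : ℕ} (hr : IsRun w n i j p)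
    (hr' : IsRun w n i' j' p) (hi' : i' ≤ s) (hj : s + p ≤ j + 1) : i' ≤ i := by
  by_contra hlt
  rcases hr'.2.2.2.2.2.2.1 with h | h
  · have := hr.1
    omega
  · refine h ?_
    rw [hr.2.2.2.2.1 (i' - 1) (by omega) (by omega)]
    congr 1
    omega

theorem IsRun.end_le {α : Type*} {w : ℕ → α} {n i j p i' j' s : ℕ} (hr : IsRun w n i j p)
    (hr' : IsRun w n i' j' p) (hi : i ≤ s) (hj' : s + p ≤ j' + 1) : j ≤ j' := by
  by_contra hlt
  have hi1 := hr.1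
  have hp := hr.2.2.1
  rcases hr'.2.2.2.2.2.2.2 with h | h
  · have := hr.2.1
    omega
  · refine h ?_
    rw [hr.2.2.2.2.1 (j' - p + 1) (by omega) (by omega)]
    congr 1
    omega

theorem RootAt.run_eq {f : ℕ → ℤ} {n i j p i' j' p' s : ℕ}
    (hr : IsRun f n i j p) (hr' : IsRun f n i' j' p')
    (h : RootAt f i j p s) (h' : RootAt f i' j' p' s) : (i, j, p) = (i', j', p') := by
  obtain rfl := h.period_eq hr hr' h'
  obtain ⟨his, hsj, -⟩ := h
  obtain ⟨his', hsj', -⟩ := h'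
  rw [le_antisymm (hr'.start_le hr his.le hsj') (hr.start_le hr' his'.le hsj),
    le_antisymm (hr.end_le hr' his.le hsj') (hr'.end_le hr his'.le hsj)]

/-- There are at most `n - 3` runs if, among the positions `2..n`, some `x` starts no root and
another `y` is not needed to start roots. -/
theorem ncard_runs_le_of_rootAt {f : ℕ → ℤ} {n x y : ℕ}
    (hx : 2 ≤ x ∧ x ≤ n) (hy : 2 ≤ y ∧ y ≤ n) (hxy : x ≠ y)
    (hxr : ∀ i j p, IsRun f n i j p → ¬ RootAt f i j p x)
    (hyr : ∀ i j p, IsRun f n i j p → ∃ s, s ≠ y ∧ RootAt f i j p s) :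
    (Runs f n).ncard ≤ n - 3 := by
  have hch : ∀ r : ℕ × ℕ × ℕ, ∃ s, r ∈ Runs f n → s ≠ y ∧ RootAt f r.1 r.2.1 r.2.2 s := fun r => by
    by_cases h : r ∈ Runs f n
    · obtain ⟨s, hs⟩ := hyr _ _ _ h
      exact ⟨s, fun _ => hs⟩
    · exact ⟨0, fun h' => absurd h' h⟩
  choose g hg using hch
  have hcard : (((Finset.Icc 2 n).erase x).erase y).card = n - 3 := by
    rw [Finset.card_erase_of_mem (by simp [hxy.symm, hy]), Finset.card_erase_of_mem (by simp [hx])]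
    simp
    omega
  rw [← hcard, ← Set.ncard_coe_finset]
  refine Set.ncard_le_ncard_of_injOn g (fun r hr => ?_) (fun r hr r' hr' h => ?_)
    (Finset.finite_toSet _)
  · obtain ⟨hne, hroot⟩ := hg r hr
    have hgx : g r ≠ x := by
      intro h
      exact hxr _ _ _ hr (h ▸ hroot)
    obtain ⟨h1, hjn, hp, -⟩ := hr
    obtain ⟨his, hsj, -⟩ := hroot
    simp only [Finset.coe_erase, Finset.coe_Icc, Set.mem_sdiff, Set.mem_singleton_iff, Set.mem_Icc]
    exact ⟨⟨by omega, hgx⟩, hne⟩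
  · have h1 := (hg r hr).2
    have h2 := (hg r' hr').2
    rw [h] at h1
    exact h1.run_eq hr hr' h2

/-- The last position where a block of the largest letter starts does not start any root. -/
theorem exists_not_rootAt {f : ℕ → ℤ} {n x : ℕ} (hpos : ∀ k, 1 ≤ k → k ≤ n → 0 < f k)
    (hend : f (n + 1) = 0) (hx : 2 ≤ x) (hxn : x ≤ n) (hne : f (x - 1) ≠ f x)
    (hmax : ∀ k, 1 ≤ k → k ≤ n → f k ≤ f x) :
    ∃ s, 2 ≤ s ∧ s ≤ n ∧ f s = f x ∧ ∀ i j p, IsRun f n i j p → ¬ RootAt f i j p s := by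
  obtain ⟨s, hs, hsmax⟩ := Finset.exists_max_image
    {k ∈ Finset.Icc 2 n | f k = f x ∧ f (k - 1) ≠ f x} id ⟨x, by simp [hx, hxn, hne]⟩
  simp only [Finset.mem_filter, Finset.mem_Icc, id] at hs hsmax
  obtain ⟨⟨hs2, hsn⟩, hsx, hsp⟩ := hs
  refine ⟨s, hs2, hsn, hsx, fun i j p hr h => ?_⟩
  have e := h.pred_eq hr
  obtain ⟨h1, hjn, hp, hlen, hper, -⟩ := hr
  obtain ⟨his, hsj, h⟩ := h
  have hp2 : 2 ≤ p := by
    by_contra hp2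
    obtain rfl : p = 1 := by omega
    rw [Nat.add_sub_cancel] at e
    omega
  have hle := hmax (s + p - 1) (by omega) (by omega)
  rcases h with ⟨-, hL⟩ | ⟨hlt, -⟩
  · have := hL.lt_last hp2
    omega
  · have hjn' : j ≠ n := by
      rintro rfl
      have := hpos (j + 1 - p) (by omega) (by omega)
      omega
    have hjs : s + p ≠ j + 1 := by
      intro hjs
      have := hmax (j + 1) (by omega) (by omega)
      rw [← hjs, Nat.add_sub_cancel] at hlt
      rw [← hjs] at this
      omega
    have := hsmax (s + p) ⟨by omega, by rw [← hper s his.le (by omega), hsx], by omega⟩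
    omega

/-- One of the last two positions is not needed to start roots. -/
theorem exists_dispensable_rootAt {f : ℕ → ℤ} {n : ℕ} (hn : 4 < n)
    (hpos : ∀ k, 1 ≤ k → k ≤ n → 0 < f k) (hend : f (n + 1) = 0) :
    ∃ y, 2 ≤ y ∧ y ≤ n ∧ f y = f n ∧
      ∀ i j p, IsRun f n i j p → ∃ s, s ≠ y ∧ RootAt f i j p s := by
  have key : ∀ y, (∀ i j p, IsRun f n i j p → RootAt f i j p y → ∃ s, s ≠ y ∧ RootAt f i j p s) →
      ∀ i j p, IsRun f n i j p → ∃ s, s ≠ y ∧ RootAt f i j p s := by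
    intro y hy i j p hr
    obtain ⟨s, hs⟩ := hr.exists_rootAt hpos hend
    by_cases h : s = y
    · exact hy i j p hr (h ▸ hs)
    · exact ⟨s, h, hs⟩
  by_cases h1 : f (n - 1) = f n
  · by_cases h2 : f (n - 2) = f (n - 1)
    · refine ⟨n, by omega, le_rfl, rfl, key n fun i j p hr h => ⟨n - 1, by omega, ?_⟩⟩
      obtain ⟨hi, hj, hp, hlen, hper, -, hl, -⟩ := hr
      obtain ⟨his, hsj, h⟩ := h
      obtain rfl : p = 1 := by omega
      have hi1 : i ≠ n - 1 := by
        rintro rfl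
        rcases hl with hl | hl
        · omega
        · exact hl h2
      have hL : ∀ g s, LyndonAt g s 1 := fun g s e he he1 => by omega
      refine ⟨by omega, by omega, ?_⟩
      rcases h with h | h
      · exact Or.inl ⟨h.1, hL _ _⟩
      · exact Or.inr ⟨h.1, hL _ _⟩
    · refine ⟨n - 1, by omega, by omega, h1, key _ fun i j p hr h => ?_⟩
      have e := h.pred_eq hr
      obtain ⟨hi, hj, hp, -⟩ := hr
      obtain ⟨his, hsj, h⟩ := h
      exfalso
      rcases (by omega : p = 1 ∨ p = 2) with rfl | rfl
      · exact h2 e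
      · rw [show n - 1 + 2 - 1 = n by omega] at e
        exact h2 (e.trans h1.symm)
  · refine ⟨n, by omega, le_rfl, rfl, key n fun i j p hr h => ?_⟩
    have e := h.pred_eq hr
    obtain ⟨hi, hj, hp, -⟩ := hr
    obtain ⟨his, hsj, h⟩ := h
    obtain rfl : p = 1 := by omega
    exact absurd e h1

/-- A string of the form `a ... a b ... b` has at most two runs. -/
theorem ncard_runs_le_two {α : Type*} {w : ℕ → α} {n k : ℕ}
    (hleft : ∀ x, 1 ≤ x → x ≤ k → w x = w 1) (hright : ∀ x, k < x → x ≤ n → w x = w n)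
    (hne : ∀ x, 1 ≤ x → x ≤ k → w x ≠ w n) : (Runs w n).ncard ≤ 2 := by
  have hsub : Runs w n ⊆ {(1, k, 1), (k + 1, n, 1)} := by
    rintro ⟨i, j, p⟩ hr
    obtain ⟨hi, hj, hp, hlen, hper, hmin, hl, hr⟩ := hr
    dsimp only at hi hj hp hlen hper hmin hl hr
    have hp1 : ∀ _ : IsPeriod w i j 1, p = 1 := fun h => by
      by_contra hne1
      exact hmin 1 le_rfl (by omega) h
    simp only [Set.mem_insert_iff, Set.mem_singleton_iff, Prod.mk.injEq]
    rcases Nat.lt_or_ge k i with hki | hki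
    · right
      obtain rfl := hp1 fun x hx hxj => by
        rw [hright x (by omega) (by omega), hright (x + 1) (by omega) (by omega)]
      refine ⟨?_, ?_, rfl⟩
      · by_contra hik
        rcases hl with rfl | hl
        · omega
        · exact hl ((hright _ (by omega) (by omega)).trans (hright _ (by omega) (by omega)).symm)
      · by_contra hjn
        rcases hr with hr | hr
        · exact hjn hr
        · exact hr ((hright _ (by omega) (by omega)).trans (hright _ (by omega) (by omega)).symm)
    rcases Nat.lt_or_ge k j with hkj | hkj
    · exfalso
      by_cases hpi : i + p ≤ k + 1
      · have := hper (k + 1 - p) (by omega) (by omega)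
        rw [show k + 1 - p + p = k + 1 by omega, hright (k + 1) (by omega) (by omega)] at this
        exact hne _ (by omega) (by omega) this
      · have := hper k hki (by omega)
        rw [hright (k + p) (by omega) (by omega)] at this
        exact hne _ (by omega) le_rfl this
    · left
      obtain rfl := hp1 fun x hx hxj => by
        rw [hleft x (by omega) (by omega), hleft (x + 1) (by omega) (by omega)]
      refine ⟨?_, ?_, rfl⟩
      · by_contra hi1
        rcases hl with hl | hl
        · exact hi1 hl
        · exact hl ((hleft _ (by omega) (by omega)).trans (hleft _ (by omega) (by omega)).symm)
      · by_contra hjk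
        rcases hr with rfl | hr
        · exact hne j (by omega) (by omega) rfl
        · exact hr ((hleft _ (by omega) (by omega)).trans (hleft _ (by omega) (by omega)).symm)
  exact (Set.ncard_le_ncard hsub (by simp)).trans ((Set.ncard_insert_le _ _).trans (by simp))

theorem runs_congr {α β : Type*} {w : ℕ → α} {v : ℕ → β} {n : ℕ}
    (h : ∀ x y, 1 ≤ x → x ≤ n → 1 ≤ y → y ≤ n → (w x = w y ↔ v x = v y)) :
    Runs w n = Runs v n := by
  ext ⟨i, j, p⟩
  simp only [Runs, IsRun, Set.mem_ofPred_eq]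
  refine and_congr_right fun hi => and_congr_right fun hj => and_congr_right fun hp =>
    and_congr_right fun hlen => ?_
  have hper : ∀ q, IsPeriod w i j q ↔ IsPeriod v i j q := fun q =>
    forall_congr' fun k => forall_congr' fun hk => forall_congr' fun hkj =>
      h _ _ (by omega) (by omega) (by omega) (by omega)
  refine and_congr (hper p) (and_congr (by simp only [hper]) (and_congr ?_ ?_))
  · by_cases h1 : i = 1
    · simp [h1]
    · simp only [h1, false_or]
      exact not_congr (h _ _ (by omega) (by omega) (by omega) (by omega))
  · by_cases h1 : j = n
    · simp [h1]
    · simp only [h1, false_or]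
      exact not_congr (h _ _ (by omega) (by omega) (by omega) (by omega))

/-- The letters of a string can be encoded by positive integers, a given one by the largest. -/
theorem exists_int_encoding {α : Type*} (w : ℕ → α) (n : ℕ) (b : α) :
    ∃ f : ℕ → ℤ, (∀ x y, 1 ≤ x → x ≤ n → 1 ≤ y → y ≤ n → (w x = w y ↔ f x = f y)) ∧
      (∀ k, 1 ≤ k → k ≤ n → 0 < f k) ∧ f (n + 1) = 0 ∧
      ∀ x, 1 ≤ x → x ≤ n → w x = b → ∀ k, 1 ≤ k → k ≤ n → f k ≤ f x := by
  classical
  let c : α → ℕ := fun a => sInf {k | 1 ≤ k ∧ w k = a}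
  have hc : ∀ x, 1 ≤ x → 1 ≤ c (w x) ∧ w (c (w x)) = w x := fun x hx =>
    Nat.sInf_mem (s := {k | 1 ≤ k ∧ w k = w x}) ⟨x, hx, rfl⟩
  have hcle : ∀ x, 1 ≤ x → c (w x) ≤ x := fun x hx => Nat.sInf_le ⟨hx, rfl⟩
  let f : ℕ → ℤ := fun k => if k ≤ n then if w k = b then n + 1 else c (w k) else 0
  have hb : ∀ k, k ≤ n → w k = b → f k = n + 1 := fun k hk h => by simp [f, hk, h]
  have hnb : ∀ k, k ≤ n → w k ≠ b → f k = c (w k) := fun k hk h => by simp [f, hk, h]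
  refine ⟨f, fun x y hx hxn hy hyn => ⟨fun h => ?_, fun h => ?_⟩, fun k hk hkn => ?_, ?_,
    fun x hx hxn hxb k hk hkn => ?_⟩
  · simp [f, hxn, hyn, h]
  · have := hcle x hx
    have := hcle y hy
    by_cases hxb : w x = b <;> by_cases hyb : w y = b
    · rw [hxb, hyb]
    · rw [hb x hxn hxb, hnb y hyn hyb] at h
      omega
    · rw [hnb x hxn hxb, hb y hyn hyb] at h
      omega
    · rw [hnb x hxn hxb, hnb y hyn hyb, Nat.cast_inj] at h
      rw [← (hc x hx).2, ← (hc y hy).2, h]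
  · have := (hc k hk).1
    by_cases h : w k = b
    · rw [hb k hkn h]
      omega
    · rw [hnb k hkn h]
      omega
  · simp [f]
  · rw [hb x hxn hxb]
    have := hcle k hk
    by_cases h : w k = b
    · rw [hb k hkn h]
    · rw [hnb k hkn h]
      omega

theorem runs_stmt11 {α : Type*} (n : ℕ) (hn : 4 < n) (w : ℕ → α) :
    (Runs w n).ncard ≤ n - 3 := by
  classical
  by_cases hA : ∃ x, 2 ≤ x ∧ x ≤ n ∧ w (x - 1) ≠ w x ∧ w x ≠ w n
  · obtain ⟨x, hx, hxn, hne, hlast⟩ := hA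
    obtain ⟨f, hf, hpos, hend, hmax⟩ := exists_int_encoding w n (w x)
    rw [runs_congr hf]
    obtain ⟨s, hs, hsn, hsx, hsr⟩ := exists_not_rootAt hpos hend hx hxn
      (fun h => hne ((hf _ _ (by omega) (by omega) (by omega) hxn).2 h))
      (hmax x (by omega) hxn rfl)
    obtain ⟨y, hy, hyn, hyf, hyr⟩ := exists_dispensable_rootAt hn hpos hend
    refine ncard_runs_le_of_rootAt ⟨hs, hsn⟩ ⟨hy, hyn⟩ ?_ hsr hyr
    rintro rfl
    exact hlast ((hf _ _ (by omega) hxn (by omega) le_rfl).2 (hsx.symm.trans hyf))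
  · push Not at hA
    have hex : ∃ m, w (m + 1) = w n := ⟨n - 1, by congr 1; omega⟩
    have hfind := Nat.find_spec hex
    have hmin : ∀ x, 1 ≤ x → x ≤ Nat.find hex → w x ≠ w n := fun x hx hxk h =>
      Nat.find_min hex (m := x - 1) (by omega) (by rwa [Nat.sub_add_cancel hx])
    generalize Nat.find hex = k at hfind hmin
    have hright : ∀ x, k + 1 ≤ x → x ≤ n → w x = w n := by
      intro x hx
      induction x, hx using Nat.le_induction with
      | base => exact fun _ => hfind
      | succ x hx ih =>
        intro hxn
        by_contra h
        exact h (hA (x + 1) (by omega) hxn (by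
          rw [Nat.add_sub_cancel, ih (by omega)]; exact Ne.symm h))
    have hkn : k < n := by
      by_contra h
      exact hmin n (by omega) (by omega) rfl
    have hleft : ∀ x, 1 ≤ x → x ≤ k → w x = w 1 := by
      intro x hx
      induction x, hx using Nat.le_induction with
      | base => exact fun _ => rfl
      | succ x hx ih =>
        intro hxk
        rw [← ih (by omega)]
        by_contra h
        exact hmin _ (by omega) hxk (hA (x + 1) (by omega) (by omega) (by
          rw [Nat.add_sub_cancel]; exact Ne.symm h))
    exact (ncard_runs_le_two hleft hright hmin).trans (by omega)
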